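/- Conversely to the projection-to-discrete-gradient direction: if u ∈ ℝ^M satisfies u = û - ((I(û) - I₀)/⟨∇̄I(û,u), z⟩) z + Δt S ∇̄I(û,u) with S = (g zᵀ - z gᵀ)/⟨∇̄I(û,u), z⟩ and ⟨∇̄I(û,u), z⟩ ≠ 0, where ∇̄I is a discrete gradient of I, then I(u) = I₀ and there exists λ ∈ ℝ such that u = û + Δt·g + λz. -/

import Mathlib

open Matrix

/-- The normalised skew matrix `(g zᵀ - z gᵀ) / (d ⬝ᵥ z)` sends `d` to `g` minus a multiple
of `z`. -/
theorem smul_vecMulVec_sub_mulVec {n K : Type*} [Fintype n] [Field K] (g z d : n → K)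
    (h : d ⬝ᵥ z ≠ 0) :
    ((d ⬝ᵥ z)⁻¹ • (vecMulVec g z - vecMulVec z g)) *ᵥ d = g - ((d ⬝ᵥ g) / (d ⬝ᵥ z)) • z := by
  rw [smul_mulVec, sub_mulVec, vecMulVec_mulVec, vecMulVec_mulVec, dotProduct_comm z d,
    dotProduct_comm g d]
  ext i
  simp only [Pi.smul_apply, Pi.sub_apply, smul_eq_mul, MulOpposite.smul_eq_mul_unop,
    MulOpposite.unop_op]
  field_simp

theorem stmt_13 {M : ℕ} (I₀ : ℝ) (I : (Fin M → ℝ) → ℝ) (hI : Differentiable ℝ I)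
    (DG : (Fin M → ℝ) → (Fin M → ℝ) → (Fin M → ℝ))
    (hDG : ∀ v u, DG v u ⬝ᵥ (u - v) = I u - I v)
    (g z uhat u : Fin M → ℝ) (Δt : ℝ)
    (hz : DG uhat u ⬝ᵥ z ≠ 0)
    (hstep : u = uhat - ((I uhat - I₀) / (DG uhat u ⬝ᵥ z)) • z
        + Δt • (((DG uhat u ⬝ᵥ z)⁻¹ • (vecMulVec g z - vecMulVec z g)).mulVec (DG uhat u))) :
    I u = I₀ ∧ ∃ lam : ℝ, u = uhat + Δt • g + lam • z := by
  rw [smul_vecMulVec_sub_mulVec g z _ hz] at hstep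
  set d := DG uhat u with hd
  have hu : u = uhat + Δt • g
      + (-((I uhat - I₀) / (d ⬝ᵥ z)) - Δt * ((d ⬝ᵥ g) / (d ⬝ᵥ z))) • z := by
    refine hstep.trans ?_
    module
  refine ⟨?_, _, hu⟩
  have hdiff : u - uhat = Δt • g
      + (-((I uhat - I₀) / (d ⬝ᵥ z)) - Δt * ((d ⬝ᵥ g) / (d ⬝ᵥ z))) • z := by
    rw [sub_eq_iff_eq_add]
    refine hu.trans ?_
    module
  have hI_diff := hDG uhat u
  rw [← hd, hdiff, dotProduct_add, dotProduct_smul, dotProduct_smul, smul_eq_mul,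
    smul_eq_mul] at hI_diff
  field_simp at hI_diff
  linarith
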